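/- arXiv:2009.09768 — 11 statements merged into one kernel-verified Lean document; each statement's English description precedes it below -/
import Mathlib

section
/- Let p be a strictly positive probability mass function on a finite product of copies of Bool, and let Y, Z, X, C, W be pairwise disjoint tuples of coordinates with a fixed assignment W = w. If Y ⊥ Z | (X,C), W=w and Z ⊥ C | (X,Y), W=w, then Y ⊥ Z | X, W=w. -/
open Finset

/-- `agrees S s v` : the full assignment `v` agrees with `s` on the tuple of coordinates `S`. -/
def agrees {ι : Type*} (S : Finset ι) (s v : ι → Bool) : Prop := ∀ i ∈ S, v i = s i

open Classical in
/-- Probability of an event under a pmf `p` on a finite product of copies of `Bool`. -/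
noncomputable def Pr {ι : Type*} [Fintype ι] [DecidableEq ι]
    (p : (ι → Bool) → ℝ) (E : (ι → Bool) → Prop) : ℝ :=
  ∑ v : ι → Bool, if E v then p v else 0

/-- Conditional probability `P(E | F)` as a ratio of probabilities. -/
noncomputable def CP {ι : Type*} [Fintype ι] [DecidableEq ι]
    (p : (ι → Bool) → ℝ) (E F : (ι → Bool) → Prop) : ℝ :=
  Pr p (fun v => E v ∧ F v) / Pr p F

/-- Context-specific conditional independence `Y ⊥ Z | X, W = w` for the pmf `p`:
for all values `y, z, x`,
`P(Y=y, Z=z | X=x, W=w) = P(Y=y | X=x, W=w) * P(Z=z | X=x, W=w)`. -/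
def CondIndep {ι : Type*} [Fintype ι] [DecidableEq ι]
    (p : (ι → Bool) → ℝ) (Y Z X W : Finset ι) (w : ι → Bool) : Prop :=
  ∀ y z x : ι → Bool,
    CP p (fun v => agrees Y y v ∧ agrees Z z v) (fun v => agrees X x v ∧ agrees W w v) =
      CP p (fun v => agrees Y y v) (fun v => agrees X x v ∧ agrees W w v) *
      CP p (fun v => agrees Z z v) (fun v => agrees X x v ∧ agrees W w v)

theorem agrees_union_ite {ι : Type*} [DecidableEq ι] {A B : Finset ι} (h : Disjoint A B)
    (a b v : ι → Bool) :
    agrees (A ∪ B) (fun i => if i ∈ B then b i else a i) v ↔ agrees A a v ∧ agrees B b v := by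
  unfold agrees
  constructor
  · intro H
    refine ⟨fun i hi => ?_, fun i hi => ?_⟩
    · have := H i (mem_union_left _ hi)
      simpa [Finset.disjoint_left.mp h hi] using this
    · have := H i (mem_union_right _ hi)
      simpa [hi] using this
  · rintro ⟨ha, hb⟩ i hi
    by_cases hB : i ∈ B
    · simpa [hB] using hb i hB
    · simpa [hB] using ha i ((mem_union.mp hi).resolve_right hB)

theorem Pr_pos {ι : Type*} [Fintype ι] [DecidableEq ι]
    {p : (ι → Bool) → ℝ} (hpos : ∀ v, 0 < p v) {E : (ι → Bool) → Prop} (h : ∃ v, E v) :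
    0 < Pr p E := by
  classical
  obtain ⟨v, hv⟩ := h
  unfold Pr
  refine Finset.sum_pos' (fun u _ => ?_) ⟨v, mem_univ _, ?_⟩
  · split_ifs
    · exact (hpos u).le
    · exact le_rfl
  · rw [if_pos hv]; exact hpos v

theorem Pr_congr {ι : Type*} [Fintype ι] [DecidableEq ι]
    (p : (ι → Bool) → ℝ) {E F : (ι → Bool) → Prop} (h : ∀ v, E v ↔ F v) :
    Pr p E = Pr p F := by
  congr 1; funext v; exact propext (h v)

theorem Pr_sum {ι : Type*} [Fintype ι] [DecidableEq ι]
    (p : (ι → Bool) → ℝ) (C : Finset ι) (E : (ι → Bool) → Prop) :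
    ∑ c ∈ univ.filter (fun c : ι → Bool => ∀ i, i ∉ C → c i = false),
      Pr p (fun v => agrees C c v ∧ E v) = Pr p E := by
  classical
  unfold Pr
  rw [Finset.sum_comm]
  refine Finset.sum_congr rfl fun v _ => ?_
  rw [Finset.sum_eq_single (fun i => if i ∈ C then v i else false)]
  · have : agrees C (fun i => if i ∈ C then v i else false) v := by
      intro i hi; simp [hi]
    simp only [this, true_and]
  · intro c hc hne
    rw [if_neg]
    rintro ⟨h, -⟩
    apply hne
    funext i
    by_cases hi : i ∈ C
    · simp [hi, h i hi]
    · simp [hi, (mem_filter.mp hc).2 i hi]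
  · intro h
    exact absurd (mem_filter.mpr ⟨mem_univ _, fun i hi => by simp [hi]⟩) h

theorem csi_intersection_case_iv {ι : Type*} [Fintype ι] [DecidableEq ι]
    (p : (ι → Bool) → ℝ) (hpos : ∀ v, 0 < p v) (hsum : ∑ v, p v = 1)
    (Y Z X C W : Finset ι) (w : ι → Bool)
    (hdisj : List.Pairwise Disjoint [Y, Z, X, C, W])
    (h1 : CondIndep p Y Z (X ∪ C) W w)
    (h2 : CondIndep p Z C (X ∪ Y) W w) :
    CondIndep p Y Z X W w := by
  intro y z x
  simp only [List.pairwise_cons, List.mem_cons, List.not_mem_nil, or_false] at hdisj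
  obtain ⟨dY, dZ, dX, dC, -⟩ := hdisj
  have dYX : Disjoint Y X := dY X (by simp)
  have dYC : Disjoint Y C := dY C (by simp)
  have dYW : Disjoint Y W := dY W (by simp)
  have dXC : Disjoint X C := dX C (by simp)
  have dXW : Disjoint X W := dX W (by simp)
  have dCW : Disjoint C W := dC W (by simp)
  have hex : ∀ c : ι → Bool, ∃ v, agrees Y y v ∧ agrees C c v ∧ agrees X x v ∧ agrees W w v := by
    intro c
    refine ⟨fun i => if i ∈ Y then y i else if i ∈ C then c i else if i ∈ X then x i else w i,
      ?_, ?_, ?_, ?_⟩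
    · intro i hi
      simp [hi]
    · intro i hi
      simp [hi, Finset.disjoint_right.mp dYC hi]
    · intro i hi
      simp [hi, Finset.disjoint_right.mp dYX hi, Finset.disjoint_left.mp dXC hi]
    · intro i hi
      simp [Finset.disjoint_right.mp dYW hi, Finset.disjoint_right.mp dXW hi,
        Finset.disjoint_right.mp dCW hi]
  have key : ∀ c : ι → Bool,
      Pr p (fun v => agrees Y y v ∧ agrees Z z v ∧ agrees X x v ∧ agrees W w v) *
        Pr p (fun v => agrees C c v ∧ agrees X x v ∧ agrees W w v) =
      Pr p (fun v => agrees C c v ∧ agrees Z z v ∧ agrees X x v ∧ agrees W w v) *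
        Pr p (fun v => agrees Y y v ∧ agrees X x v ∧ agrees W w v) := by
    intro c
    have e1 := h1 y z (fun i => if i ∈ C then c i else x i)
    have e2 := h2 z c (fun i => if i ∈ Y then y i else x i)
    simp only [CP, agrees_union_ite dXC, agrees_union_ite dYX.symm] at e1 e2
    obtain ⟨v, hY, hC, hX, hW⟩ := hex c
    have p1 : 0 < Pr p (fun v => agrees C c v ∧ agrees X x v ∧ agrees W w v) :=
      Pr_pos hpos ⟨v, hC, hX, hW⟩
    have p2 : 0 < Pr p (fun v => agrees Y y v ∧ agrees X x v ∧ agrees W w v) :=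
      Pr_pos hpos ⟨v, hY, hX, hW⟩
    have p3 : 0 < Pr p (fun v => agrees Y y v ∧ agrees C c v ∧ agrees X x v ∧ agrees W w v) :=
      Pr_pos hpos ⟨v, hY, hC, hX, hW⟩
    rw [Pr_congr p (F := fun v => agrees Y y v ∧ agrees Z z v ∧ agrees C c v ∧ agrees X x v ∧
          agrees W w v) (E := fun v => (agrees Y y v ∧ agrees Z z v) ∧ _) (by intro v; tauto),
      Pr_congr p (F := fun v => agrees C c v ∧ agrees X x v ∧ agrees W w v)
        (E := fun v => (agrees X x v ∧ agrees C c v) ∧ agrees W w v) (by intro v; tauto),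
      Pr_congr p (F := fun v => agrees Y y v ∧ agrees C c v ∧ agrees X x v ∧ agrees W w v)
        (E := fun v => agrees Y y v ∧ (agrees X x v ∧ agrees C c v) ∧ agrees W w v) (by intro v; tauto),
      Pr_congr p (F := fun v => agrees C c v ∧ agrees Z z v ∧ agrees X x v ∧ agrees W w v)
        (E := fun v => agrees Z z v ∧ _) (by intro v; tauto)] at e1
    rw [Pr_congr p (F := fun v => agrees Y y v ∧ agrees Z z v ∧ agrees C c v ∧ agrees X x v ∧
          agrees W w v) (E := fun v => (agrees Z z v ∧ agrees C c v) ∧ _) (by intro v; tauto),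
      Pr_congr p (F := fun v => agrees Y y v ∧ agrees X x v ∧ agrees W w v)
        (E := fun v => (agrees X x v ∧ agrees Y y v) ∧ agrees W w v) (by intro v; tauto),
      Pr_congr p (F := fun v => agrees Y y v ∧ agrees C c v ∧ agrees X x v ∧ agrees W w v)
        (E := fun v => agrees C c v ∧ _) (by intro v; tauto),
      Pr_congr p (F := fun v => agrees Y y v ∧ agrees Z z v ∧ agrees X x v ∧ agrees W w v)
        (E := fun v => agrees Z z v ∧ _) (by intro v; tauto)] at e2
    generalize Pr p (fun v => agrees C c v ∧ agrees X x v ∧ agrees W w v) = c1 at *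
    generalize Pr p (fun v => agrees Y y v ∧ agrees X x v ∧ agrees W w v) = c2 at *
    generalize Pr p (fun v => agrees Y y v ∧ agrees C c v ∧ agrees X x v ∧ agrees W w v) = c3 at *
    rw [div_mul_div_comm, div_eq_div_iff p1.ne' (mul_pos p1 p1).ne'] at e1
    rw [div_mul_div_comm, div_eq_div_iff p2.ne' (mul_pos p2 p2).ne'] at e2
    have f1 := mul_right_cancel₀ p1.ne' ((mul_assoc _ _ _).trans e1)
    have f2 := mul_right_cancel₀ p2.ne' ((mul_assoc _ _ _).trans e2)
    apply mul_right_cancel₀ p3.ne'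
    linear_combination c2 * f1 - c1 * f2
  have tot := Finset.sum_congr
    (rfl : univ.filter (fun c : ι → Bool => ∀ i, i ∉ C → c i = false) = _) fun c _ => key c
  rw [← Finset.mul_sum, ← Finset.sum_mul, Pr_sum, Pr_sum] at tot
  obtain ⟨v, hY, hC, hX, hW⟩ := hex x
  have p0 : 0 < Pr p (fun v => agrees X x v ∧ agrees W w v) := Pr_pos hpos ⟨v, hX, hW⟩
  simp only [CP, and_assoc]
  rw [div_mul_div_comm, div_eq_div_iff p0.ne' (mul_pos p0 p0).ne']
  linear_combination Pr p (fun v => agrees X x v ∧ agrees W w v) * tot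
end

section
/- Let p be a strictly positive probability mass function on a finite product of copies of Bool, and let Y₁, Y₂, Z₁, Z₂, X₁, X₂ be pairwise disjoint tuples of coordinates with fixed assignments Y₂=y₂, Z₂=z₂, X₂=x₂. If (Y₁,Y₂) ⊥ (Z₁,Z₂) | X₁, X₂=x₂, then for all values y₁, z₁, x₁: P(Y₁=y₁, Y₂=y₂ | Z₁=z₁, Z₂=z₂, X₁=x₁, X₂=x₂) = P(Y₁=y₁, Y₂=y₂ | X₁=x₁, X₂=x₂). -/
open Finset

lemma agrees_union_aux {ι : Type*} [DecidableEq ι] (S T : Finset ι) (hST : Disjoint S T)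
    (s t v : ι → Bool) :
    agrees (S ∪ T) (fun i => if i ∈ S then s i else t i) v ↔ agrees S s v ∧ agrees T t v := by
  unfold agrees
  rw [Finset.disjoint_left] at hST
  constructor
  · intro h
    refine ⟨fun i hi => ?_, fun i hi => ?_⟩
    · simpa [hi] using h i (by simp [hi])
    · have hn : i ∉ S := fun hs => hST hs hi
      simpa [hn] using h i (by simp [hi])
  · rintro ⟨h1, h2⟩ i hi
    by_cases hs : i ∈ S
    · simpa [hs] using h1 i hs
    · have ht : i ∈ T := by simpa [hs] using hi
      simpa [hs] using h2 i ht

lemma Pr_pos_aux {ι : Type*} [Fintype ι] [DecidableEq ι]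
    (p : (ι → Bool) → ℝ) (hpos : ∀ v, 0 < p v) (E : (ι → Bool) → Prop) (v : ι → Bool)
    (hv : E v) : 0 < Pr p E := by
  unfold Pr
  refine Finset.sum_pos' (fun w _ => ?_) ⟨v, Finset.mem_univ _, ?_⟩
  · split_ifs
    · exact (hpos w).le
    · exact le_rfl
  · rw [if_pos hv]; exact hpos v

theorem rule1_soundness {ι : Type*} [Fintype ι] [DecidableEq ι]
    (p : (ι → Bool) → ℝ) (hpos : ∀ v, 0 < p v) (hsum : ∑ v, p v = 1)
    (Y₁ Y₂ Z₁ Z₂ X₁ X₂ : Finset ι) (y₂ z₂ x₂ : ι → Bool)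
    (hdisj : List.Pairwise Disjoint [Y₁, Y₂, Z₁, Z₂, X₁, X₂])
    (h : CondIndep p (Y₁ ∪ Y₂) (Z₁ ∪ Z₂) X₁ X₂ x₂) :
    ∀ y₁ z₁ x₁ : ι → Bool,
      CP p (fun v => agrees Y₁ y₁ v ∧ agrees Y₂ y₂ v)
        (fun v => agrees Z₁ z₁ v ∧ agrees Z₂ z₂ v ∧ agrees X₁ x₁ v ∧ agrees X₂ x₂ v) =
      CP p (fun v => agrees Y₁ y₁ v ∧ agrees Y₂ y₂ v)
        (fun v => agrees X₁ x₁ v ∧ agrees X₂ x₂ v) := by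
  intro y₁ z₁ x₁
  simp only [List.pairwise_cons, List.mem_cons, List.not_mem_nil, or_false, forall_eq_or_imp,
    forall_eq] at hdisj
  obtain ⟨⟨hY, -⟩, -, ⟨hZ, hZX1, hZX2⟩, ⟨hZ2X1, hZ2X2⟩, hX, -⟩ := hdisj
  have key := h (fun i => if i ∈ Y₁ then y₁ i else y₂ i) (fun i => if i ∈ Z₁ then z₁ i else z₂ i) x₁
  simp only [agrees_union_aux _ _ hY, agrees_union_aux _ _ hZ] at key
  have hw : ∃ v, agrees Z₁ z₁ v ∧ agrees Z₂ z₂ v ∧ agrees X₁ x₁ v ∧ agrees X₂ x₂ v := by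
    rw [Finset.disjoint_left] at hZ hZX1 hZX2 hZ2X1 hZ2X2 hX
    refine ⟨fun i => if i ∈ Z₁ then z₁ i else if i ∈ Z₂ then z₂ i else
      if i ∈ X₁ then x₁ i else x₂ i, ?_, ?_, ?_, ?_⟩ <;> intro i hi <;> grind
  obtain ⟨v, hv⟩ := hw
  have hP1 := Pr_pos_aux p hpos (fun v => agrees Z₁ z₁ v ∧ agrees Z₂ z₂ v ∧ agrees X₁ x₁ v ∧
    agrees X₂ x₂ v) v hv
  have hP2 := Pr_pos_aux p hpos (fun v => agrees X₁ x₁ v ∧ agrees X₂ x₂ v) v hv.2.2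
  unfold CP at key ⊢
  simp only [and_assoc] at key ⊢
  field_simp at key ⊢
  linarith
end

section
/- Let α, λ be strictly positive probability mass functions on Bool, let f(·|a,l) be, for each (a,l) ∈ Bool², a strictly positive probability mass function on Bool, and let g(·|x,a,l) be, for each (x,a,l) ∈ Bool³, a strictly positive probability mass function on Bool. Define the joint pmf p on Bool⁴ (coordinates A, L, X, Y) by p(a,l,x,y) = α(a)·λ(l)·f(x|a,l)·g(y|x,a,l). Assume the context-specific independences: f(x|0,l) does not depend on l, and g(y|x,1,l) does not depend on x. Then for all x, y: Σ_{a,l} α(a)·λ(l)·g(y|x,a,l) = P(Y=y | A=0, X=x)·P(A=0) + P(Y=y | A=1)·P(A=1), where P denotes probabilities and conditional probabilities computed from the joint pmf p. -/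
/-- Equation (1) of the paper: identification of `P(Y | do(X))` in the causal model of
Figure 1 (binary `A, L, X, Y`; `A → X`, `A → Y`, `L → X`, `L → Y`, `X → Y`; `L` latent),
with joint pmf `p a l x y = α a * λ l * f x a l * g y x a l`, under the context-specific
independences `X ⊥ L | A = 0` (i.e. `f x false l` does not depend on `l`) and
`Y ⊥ X | A = 1, L` (i.e. `g y x true l` does not depend on `x`).  The causal effect
`P(Y=y | do(X=x)) = Σ_{a,l} α a * λ l * g y x a l` equals
`P(Y=y | A=0, X=x) * P(A=0) + P(Y=y | A=1) * P(A=1)`, all probabilities computed from `p`. -/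
theorem equation_one
    (α lam : Bool → ℝ)
    (f : Bool → Bool → Bool → ℝ)      -- f x a l = f(x | a, l)
    (g : Bool → Bool → Bool → Bool → ℝ)  -- g y x a l = g(y | x, a, l)
    (hα_pos : ∀ a, 0 < α a) (hα_sum : ∑ a : Bool, α a = 1)
    (hlam_pos : ∀ l, 0 < lam l) (hlam_sum : ∑ l : Bool, lam l = 1)
    (hf_pos : ∀ x a l, 0 < f x a l) (hf_sum : ∀ a l, ∑ x : Bool, f x a l = 1)
    (hg_pos : ∀ y x a l, 0 < g y x a l) (hg_sum : ∀ x a l, ∑ y : Bool, g y x a l = 1)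
    (hcsi1 : ∀ x l l', f x false l = f x false l')
    (hcsi2 : ∀ y x x' l, g y x true l = g y x' true l) :
    ∀ x y : Bool,
      (∑ a : Bool, ∑ l : Bool, α a * lam l * g y x a l) =
        -- P(Y=y | A=0, X=x) * P(A=0)
        ((∑ l : Bool, α false * lam l * f x false l * g y x false l) /
            (∑ l : Bool, ∑ y' : Bool, α false * lam l * f x false l * g y' x false l)) *
          (∑ l : Bool, ∑ x' : Bool, ∑ y' : Bool,
            α false * lam l * f x' false l * g y' x' false l) +
        -- P(Y=y | A=1) * P(A=1)
        ((∑ l : Bool, ∑ x' : Bool, α true * lam l * f x' true l * g y x' true l) /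
            (∑ l : Bool, ∑ x' : Bool, ∑ y' : Bool,
              α true * lam l * f x' true l * g y' x' true l)) *
          (∑ l : Bool, ∑ x' : Bool, ∑ y' : Bool,
            α true * lam l * f x' true l * g y' x' true l) := by
  intro x y
  have hA : ∀ a, (∑ l : Bool, ∑ x' : Bool, ∑ y' : Bool,
      α a * lam l * f x' a l * g y' x' a l) = α a := by
    intro a
    simp_rw [← Finset.mul_sum, hg_sum, mul_one, ← Finset.mul_sum, hf_sum, mul_one,
      ← Finset.mul_sum, hlam_sum, mul_one]
  have hD : (∑ l : Bool, ∑ y' : Bool, α false * lam l * f x false l * g y' x false l)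
      = α false * f x false false := by
    simp_rw [← Finset.mul_sum, hg_sum, mul_one, hcsi1 x _ false, ← Finset.sum_mul,
      ← Finset.mul_sum, hlam_sum, mul_one]
  have hN : (∑ l : Bool, α false * lam l * f x false l * g y x false l)
      = f x false false * ∑ l : Bool, α false * lam l * g y x false l := by
    rw [Finset.mul_sum]
    refine Finset.sum_congr rfl fun l _ => ?_
    rw [hcsi1 x l false]; ring
  have hT : (∑ l : Bool, ∑ x' : Bool, α true * lam l * f x' true l * g y x' true l)
      = ∑ l : Bool, α true * lam l * g y x true l := by
    refine Finset.sum_congr rfl fun l _ => ?_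
    simp_rw [hcsi2 y _ x l, ← Finset.sum_mul, ← Finset.mul_sum, hf_sum, mul_one]
  have h0 := (hα_pos false).ne'
  have h1 := (hα_pos true).ne'
  have h2 := (hf_pos x false false).ne'
  rw [hA, hA, hD, hN, hT, div_mul_cancel₀ _ h1, Fintype.sum_bool, add_comm]
  congr 1
  field_simp
end

section
/- Let ω, ζ be strictly positive probability mass functions on Bool, let f(·|w,z) be, for each (w,z) ∈ Bool², a strictly positive probability mass function on Bool, and let g(·|x,z) be, for each (x,z) ∈ Bool², a strictly positive probability mass function on Bool. Define the joint pmf p on Bool⁴ (coordinates W, Z, X, Y) by p(w,z,x,y) = ω(w)·ζ(z)·f(x|w,z)·g(y|x,z). Assume f(x|1,z) does not depend on z. Then for all x, y: Σ_z ζ(z)·g(y|x,z) = P(Y=y | X=x, W=1), where P denotes probabilities computed from p. -/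
/-- Identification formula for Figure 4(a) of the paper: binary `W, Z, X, Y` with
structure `W → X`, `Z → X`, `Z → Y`, `X → Y` and `Z` latent, joint pmf
`p w z x y = ω w * ζ z * f x w z * g y x z`, with the context-specific independence
`X ⊥ Z | W = 1` (i.e. `f x true z` does not depend on `z`).  Then
`P(Y=y | do(X=x)) = Σ_z ζ z * g y x z = P(Y=y | X=x, W=1)`. -/
theorem figure_4a
    (ω ζ : Bool → ℝ)
    (f : Bool → Bool → Bool → ℝ)   -- f x w z = f(x | w, z)
    (g : Bool → Bool → Bool → ℝ)   -- g y x z = g(y | x, z)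
    (hω_pos : ∀ w, 0 < ω w) (hω_sum : ∑ w : Bool, ω w = 1)
    (hζ_pos : ∀ z, 0 < ζ z) (hζ_sum : ∑ z : Bool, ζ z = 1)
    (hf_pos : ∀ x w z, 0 < f x w z) (hf_sum : ∀ w z, ∑ x : Bool, f x w z = 1)
    (hg_pos : ∀ y x z, 0 < g y x z) (hg_sum : ∀ x z, ∑ y : Bool, g y x z = 1)
    (hcsi : ∀ x z z', f x true z = f x true z') :
    ∀ x y : Bool,
      (∑ z : Bool, ζ z * g y x z) =
        -- P(Y=y | X=x, W=1)
        (∑ z : Bool, ω true * ζ z * f x true z * g y x z) /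
          (∑ z : Bool, ∑ y' : Bool, ω true * ζ z * f x true z * g y' x z) := by
  intro x y
  have hden : (∑ z : Bool, ∑ y' : Bool, ω true * ζ z * f x true z * g y' x z)
      = ω true * f x true true := by
    calc _ = ∑ z : Bool, ω true * f x true true * ζ z := by
          refine Finset.sum_congr rfl fun z _ => ?_
          rw [← Finset.mul_sum, hg_sum, hcsi x z true]
          ring
      _ = _ := by rw [← Finset.mul_sum, hζ_sum, mul_one]
  have hne : ω true * f x true true ≠ 0 :=
    (mul_pos (hω_pos true) (hf_pos x true true)).ne'
  rw [hden, eq_div_iff hne, Finset.sum_mul]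
  refine Finset.sum_congr rfl fun z _ => ?_
  rw [hcsi x z true]
  ring
end

section
/- Let α, η be strictly positive probability mass functions on Bool, and let f(·|h), k(·|x,a), g(·|z,a,h) be strictly positive probability mass functions on Bool for each value of their conditioning arguments in Bool, Bool², Bool³ respectively. Define the joint pmf p on Bool⁵ (coordinates A, H, X, Z, Y) by p(a,h,x,z,y) = α(a)·η(h)·f(x|h)·k(z|x,a)·g(y|z,a,h). Assume the context-specific independences: k(z|x,0) does not depend on x, and g(y|z,1,h) does not depend on z. Then for all x, y: Σ_{a,h,z} α(a)·η(h)·k(z|x,a)·g(y|z,a,h) = P(Y=y), where P(Y=y) is the marginal probability of Y=y under p. -/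
/-- Identification formula for Figure 4(b) of the paper: binary `X, Z, Y` and latent
`A, H` with structure `H → X`, `X → Z`, `A → Z`, `A → Y`, `Z → Y`, `H → Y`, joint pmf
`p a h x z y = α a * η h * f x h * k z x a * g y z a h`, with the context-specific
independences `Z ⊥ X | A = 0` (i.e. `k z x false` does not depend on `x`) and
`Y ⊥ Z | A = 1, H` (i.e. `g y z true h` does not depend on `z`).  Then
`P(Y=y | do(X=x)) = Σ_{a,h,z} α a * η h * k z x a * g y z a h = P(Y=y)`. -/
theorem figure_4b
    (α η : Bool → ℝ)
    (f : Bool → Bool → ℝ)              -- f x h = f(x | h)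
    (k : Bool → Bool → Bool → ℝ)       -- k z x a = k(z | x, a)
    (g : Bool → Bool → Bool → Bool → ℝ)  -- g y z a h = g(y | z, a, h)
    (hα_pos : ∀ a, 0 < α a) (hα_sum : ∑ a : Bool, α a = 1)
    (hη_pos : ∀ h, 0 < η h) (hη_sum : ∑ h : Bool, η h = 1)
    (hf_pos : ∀ x h, 0 < f x h) (hf_sum : ∀ h, ∑ x : Bool, f x h = 1)
    (hk_pos : ∀ z x a, 0 < k z x a) (hk_sum : ∀ x a, ∑ z : Bool, k z x a = 1)
    (hg_pos : ∀ y z a h, 0 < g y z a h) (hg_sum : ∀ z a h, ∑ y : Bool, g y z a h = 1)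
    (hcsi1 : ∀ z x x', k z x false = k z x' false)
    (hcsi2 : ∀ y z z' h, g y z true h = g y z' true h) :
    ∀ x y : Bool,
      (∑ a : Bool, ∑ h : Bool, ∑ z : Bool, α a * η h * k z x a * g y z a h) =
        -- P(Y=y)
        (∑ a : Bool, ∑ h : Bool, ∑ x' : Bool, ∑ z : Bool,
          α a * η h * f x' h * k z x' a * g y z a h) := by
  intro x y
  have key : ∀ x' a h, ∑ z : Bool, k z x' a * g y z a h = ∑ z : Bool, k z x a * g y z a h := by
    intro x' a h
    cases a with
    | false => exact Finset.sum_congr rfl fun z _ => by rw [hcsi1 z x' x]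
    | true =>
      have aux : ∀ w, ∑ z : Bool, k z w true * g y z true h = g y true true h := by
        intro w
        rw [Finset.sum_congr rfl fun z _ => by rw [hcsi2 y z true h], ← Finset.sum_mul,
          hk_sum, one_mul]
      rw [aux, aux]
  refine Finset.sum_congr rfl fun a _ => Finset.sum_congr rfl fun h _ => ?_
  calc ∑ z : Bool, α a * η h * k z x a * g y z a h
      = α a * η h * ∑ z : Bool, k z x a * g y z a h := by
        rw [Finset.mul_sum]
        exact Finset.sum_congr rfl fun z _ => by ring
    _ = ∑ x' : Bool, f x' h * (α a * η h * ∑ z : Bool, k z x a * g y z a h) := by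
        rw [← Finset.sum_mul, hf_sum, one_mul]
    _ = _ := by
        refine Finset.sum_congr rfl fun x' _ => ?_
        rw [← key x' a h, Finset.mul_sum, Finset.mul_sum]
        exact Finset.sum_congr rfl fun z _ => by ring
end

section
/- Let η, κ be strictly positive probability mass functions on Bool, and let k(·|q,h), f(·|h,z), g(·|x,z,q) be strictly positive probability mass functions on Bool for each value of their conditioning arguments in Bool², Bool², Bool³ respectively. Define the joint pmf p on Bool⁵ (coordinates H, Q, Z, X, Y) by p(h,q,z,x,y) = η(h)·κ(q)·k(z|q,h)·f(x|h,z)·g(y|x,z,q). Assume the context-specific independences: g(y|x,0,q) does not depend on q, and g(y|x,1,q) does not depend on x. Then for all x, y: Σ_{h,q,z} η(h)·κ(q)·k(z|q,h)·g(y|x,z,q) = P(Y=y | Z=0, X=x)·P(Z=0) + P(Y=y | Z=1)·P(Z=1), where P denotes probabilities and conditional probabilities computed from p. -/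
/-- Identification formula for Figure 4(c) of the paper: binary `X, Z, Y` and latent
`Q, H` with structure `Q → Z`, `Q → Y`, `H → X`, `H → Z`, `Z → X`, `Z → Y`, `X → Y`,
joint pmf `p h q z x y = η h * κ q * k z q h * f x h z * g y x z q`, with the
context-specific independences `Y ⊥ Q | X, Z = 0` (i.e. `g y x false q` does not depend
on `q`) and `Y ⊥ X | Z = 1, Q` (i.e. `g y x true q` does not depend on `x`).  Then
`P(Y=y | do(X=x)) = Σ_{h,q,z} η h * κ q * k z q h * g y x z q
  = P(Y=y | Z=0, X=x) * P(Z=0) + P(Y=y | Z=1) * P(Z=1)`. -/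
theorem figure_4c
    (η κ : Bool → ℝ)
    (k : Bool → Bool → Bool → ℝ)        -- k z q h = k(z | q, h)
    (f : Bool → Bool → Bool → ℝ)        -- f x h z = f(x | h, z)
    (g : Bool → Bool → Bool → Bool → ℝ)  -- g y x z q = g(y | x, z, q)
    (hη_pos : ∀ h, 0 < η h) (hη_sum : ∑ h : Bool, η h = 1)
    (hκ_pos : ∀ q, 0 < κ q) (hκ_sum : ∑ q : Bool, κ q = 1)
    (hk_pos : ∀ z q h, 0 < k z q h) (hk_sum : ∀ q h, ∑ z : Bool, k z q h = 1)
    (hf_pos : ∀ x h z, 0 < f x h z) (hf_sum : ∀ h z, ∑ x : Bool, f x h z = 1)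
    (hg_pos : ∀ y x z q, 0 < g y x z q) (hg_sum : ∀ x z q, ∑ y : Bool, g y x z q = 1)
    (hcsi1 : ∀ y x q q', g y x false q = g y x false q')
    (hcsi2 : ∀ y x x' q, g y x true q = g y x' true q) :
    ∀ x y : Bool,
      (∑ h : Bool, ∑ q : Bool, ∑ z : Bool, η h * κ q * k z q h * g y x z q) =
        -- P(Y=y | Z=0, X=x) * P(Z=0)
        ((∑ h : Bool, ∑ q : Bool, η h * κ q * k false q h * f x h false * g y x false q) /
            (∑ h : Bool, ∑ q : Bool, ∑ y' : Bool,
              η h * κ q * k false q h * f x h false * g y' x false q)) *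
          (∑ h : Bool, ∑ q : Bool, ∑ x' : Bool, ∑ y' : Bool,
            η h * κ q * k false q h * f x' h false * g y' x' false q) +
        -- P(Y=y | Z=1) * P(Z=1)
        ((∑ h : Bool, ∑ q : Bool, ∑ x' : Bool,
            η h * κ q * k true q h * f x' h true * g y x' true q) /
            (∑ h : Bool, ∑ q : Bool, ∑ x' : Bool, ∑ y' : Bool,
              η h * κ q * k true q h * f x' h true * g y' x' true q)) *
          (∑ h : Bool, ∑ q : Bool, ∑ x' : Bool, ∑ y' : Bool,
            η h * κ q * k true q h * f x' h true * g y' x' true q) := by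
  intro x y
  have hA : 0 < ∑ h : Bool, ∑ q : Bool, η h * κ q * k false q h * f x h false :=
    Finset.sum_pos (fun h _ => Finset.sum_pos (fun q _ =>
      mul_pos (mul_pos (mul_pos (hη_pos h) (hκ_pos q)) (hk_pos _ _ _)) (hf_pos _ _ _))
      Finset.univ_nonempty) Finset.univ_nonempty
  have hB : 0 < ∑ h : Bool, ∑ q : Bool, η h * κ q * k true q h :=
    Finset.sum_pos (fun h _ => Finset.sum_pos (fun q _ =>
      mul_pos (mul_pos (hη_pos h) (hκ_pos q)) (hk_pos _ _ _))
      Finset.univ_nonempty) Finset.univ_nonempty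
  have h1 : ∀ q, g y x false q = g y x false false := fun q => hcsi1 y x q false
  have h2 : ∀ x' q, g y x' true q = g y x true q := fun x' q => hcsi2 y x' x q
  have hN : (∑ h : Bool, ∑ q : Bool, ∑ x' : Bool,
      η h * κ q * k true q h * f x' h true * g y x' true q) =
      ∑ h : Bool, ∑ q : Bool, η h * κ q * k true q h * g y x true q := by
    simp only [h2, ← Finset.sum_mul, ← Finset.mul_sum, hf_sum, mul_one]
  have hM : (∑ h : Bool, ∑ q : Bool,
      η h * κ q * k false q h * f x h false * g y x false q) =
      (∑ h : Bool, ∑ q : Bool, η h * κ q * k false q h * f x h false) * g y x false false := by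
    simp only [h1, Finset.sum_mul]
  have hD : (∑ h : Bool, ∑ q : Bool, ∑ y' : Bool,
      η h * κ q * k false q h * f x h false * g y' x false q) =
      ∑ h : Bool, ∑ q : Bool, η h * κ q * k false q h * f x h false := by
    simp only [← Finset.mul_sum _ (fun y' => g y' _ _ _), hg_sum, mul_one]
  have hZ : ∀ z, (∑ h : Bool, ∑ q : Bool, ∑ x' : Bool, ∑ y' : Bool,
      η h * κ q * k z q h * f x' h z * g y' x' z q) =
      ∑ h : Bool, ∑ q : Bool, η h * κ q * k z q h := by
    intro z
    refine Finset.sum_congr rfl fun h _ => Finset.sum_congr rfl fun q _ => ?_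
    simp only [← Finset.mul_sum, hg_sum, hf_sum, mul_one]
  rw [hN, hM, hD, hZ, hZ, mul_div_cancel_left₀ _ hA.ne', div_mul_cancel₀ _ hB.ne']
  simp only [Fintype.sum_bool, h1 true]
  ring
end

section
/- Let ω, α, υ be strictly positive probability mass functions on Bool, and let f(·|w,u), k(·|x,a), g(·|w,x,z,a,u) be strictly positive probability mass functions on Bool for each value of their conditioning arguments in Bool², Bool², Bool⁵ respectively. Define the joint pmf p on Bool⁶ (coordinates W, A, U, X, Z, Y) by p(w,a,u,x,z,y) = ω(w)·α(a)·υ(u)·f(x|w,u)·k(z|x,a)·g(y|w,x,z,a,u). Assume the context-specific independences: g(y|w,x,z,0,u) does not depend on w; g(y|w,x,z,0,u) does not depend on x; k(z|x,1) does not depend on x; g(y|w,x,z,1,u) does not depend on u. Then for all x, y: Σ_{w,a,u,z} ω(w)·α(a)·υ(u)·k(z|x,a)·g(y|w,x,z,a,u) = P(A=1)·Σ_w P(Y=y | X=x, W=w, A=1)·P(W=w | A=1) + P(A=0)·Σ_z P(Z=z | X=x, A=0)·Σ_{x'} P(Y=y | X=x', Z=z, A=0)·P(X=x' | A=0), where P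 denotes probabilities and conditional probabilities computed from p. -/
/-- Identification formula for Figure 4(d) of the paper: binary observed `W, X, Z, A, Y`
and latent `U` with structure `W → X`, `W → Y`, `X → Y`, `X → Z`, `Z → Y`, `A → Y`,
`A → Z`, `U → X`, `U → Y`, joint pmf
`p w a u x z y = ω w * α a * υ u * f x w u * k z x a * g y w x z a u`, with the
context-specific independences `Y ⊥ W | A = 0`, `Y ⊥ X | A = 0`, `Z ⊥ X | A = 1` and
`Y ⊥ U | A = 1`.  Then `P(Y=y | do(X=x)) = Σ_{w,a,u,z} ω w * α a * υ u * k z x a * g y w x z a u`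
equals the combined back-door (context `A = 1`, adjusting for `W`) and front-door
(context `A = 0`, through `Z`) formula. -/
theorem figure_4d
    (ω α υ : Bool → ℝ)
    (f : Bool → Bool → Bool → ℝ)        -- f x w u = f(x | w, u)
    (k : Bool → Bool → Bool → ℝ)        -- k z x a = k(z | x, a)
    (g : Bool → Bool → Bool → Bool → Bool → Bool → ℝ)  -- g y w x z a u = g(y | w, x, z, a, u)
    (hω_pos : ∀ w, 0 < ω w) (hω_sum : ∑ w : Bool, ω w = 1)
    (hα_pos : ∀ a, 0 < α a) (hα_sum : ∑ a : Bool, α a = 1)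
    (hυ_pos : ∀ u, 0 < υ u) (hυ_sum : ∑ u : Bool, υ u = 1)
    (hf_pos : ∀ x w u, 0 < f x w u) (hf_sum : ∀ w u, ∑ x : Bool, f x w u = 1)
    (hk_pos : ∀ z x a, 0 < k z x a) (hk_sum : ∀ x a, ∑ z : Bool, k z x a = 1)
    (hg_pos : ∀ y w x z a u, 0 < g y w x z a u)
    (hg_sum : ∀ w x z a u, ∑ y : Bool, g y w x z a u = 1)
    (hcsi1 : ∀ y w w' x z u, g y w x z false u = g y w' x z false u)
    (hcsi2 : ∀ y w x x' z u, g y w x z false u = g y w x' z false u)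
    (hcsi3 : ∀ z x x', k z x true = k z x' true)
    (hcsi4 : ∀ y w x z u u', g y w x z true u = g y w x z true u') :
    ∀ x y : Bool,
      (∑ w : Bool, ∑ a : Bool, ∑ u : Bool, ∑ z : Bool,
        ω w * α a * υ u * k z x a * g y w x z a u) =
        -- P(A=1) * Σ_w P(Y=y | X=x, W=w, A=1) * P(W=w | A=1)
        (∑ w : Bool, ∑ u : Bool, ∑ x' : Bool, ∑ z' : Bool, ∑ y' : Bool,
          ω w * α true * υ u * f x' w u * k z' x' true * g y' w x' z' true u) *
        (∑ w : Bool,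
          ((∑ u : Bool, ∑ z' : Bool, ω w * α true * υ u * f x w u * k z' x true * g y w x z' true u) /
            (∑ u : Bool, ∑ z' : Bool, ∑ y' : Bool,
              ω w * α true * υ u * f x w u * k z' x true * g y' w x z' true u)) *
          ((∑ u : Bool, ∑ x' : Bool, ∑ z' : Bool, ∑ y' : Bool,
            ω w * α true * υ u * f x' w u * k z' x' true * g y' w x' z' true u) /
            (∑ w' : Bool, ∑ u : Bool, ∑ x' : Bool, ∑ z' : Bool, ∑ y' : Bool,
              ω w' * α true * υ u * f x' w' u * k z' x' true * g y' w' x' z' true u))) +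
        -- P(A=0) * Σ_z P(Z=z | X=x, A=0) * Σ_{x'} P(Y=y | X=x', Z=z, A=0) * P(X=x' | A=0)
        (∑ w : Bool, ∑ u : Bool, ∑ x' : Bool, ∑ z' : Bool, ∑ y' : Bool,
          ω w * α false * υ u * f x' w u * k z' x' false * g y' w x' z' false u) *
        (∑ z : Bool,
          ((∑ w : Bool, ∑ u : Bool, ∑ y' : Bool,
            ω w * α false * υ u * f x w u * k z x false * g y' w x z false u) /
            (∑ w : Bool, ∑ u : Bool, ∑ z' : Bool, ∑ y' : Bool,
              ω w * α false * υ u * f x w u * k z' x false * g y' w x z' false u)) *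
          (∑ x' : Bool,
            ((∑ w : Bool, ∑ u : Bool,
              ω w * α false * υ u * f x' w u * k z x' false * g y w x' z false u) /
              (∑ w : Bool, ∑ u : Bool, ∑ y' : Bool,
                ω w * α false * υ u * f x' w u * k z x' false * g y' w x' z false u)) *
            ((∑ w : Bool, ∑ u : Bool, ∑ z' : Bool, ∑ y' : Bool,
              ω w * α false * υ u * f x' w u * k z' x' false * g y' w x' z' false u) /
              (∑ w : Bool, ∑ u : Bool, ∑ x'' : Bool, ∑ z' : Bool, ∑ y' : Bool,
                ω w * α false * υ u * f x'' w u * k z' x'' false * g y' w x'' z' false u)))) := by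
  intro x y
  have hS1 : ∑ w : Bool, ω w * α true = α true := by
    rw [← Finset.sum_mul, hω_sum, one_mul]
  have hS0 : ∑ w : Bool, ω w * α false = α false := by
    rw [← Finset.sum_mul, hω_sum, one_mul]
  simp only [← Finset.mul_sum, hg_sum, hk_sum, hf_sum, hυ_sum, mul_one, hS1, hS0]
  have ha1 := (hα_pos true).ne'
  have ha0 := (hα_pos false).ne'
  -- context `A = 1`
  have hT1 : ∀ w, (∑ u : Bool, ∑ z' : Bool,
      ω w * α true * υ u * f x w u * k z' x true * g y w x z' true u) /
      (∑ i : Bool, ω w * α true * υ i * f x w i) = ∑ z', k z' x true * g y w x z' true true := by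
    intro w
    have hpos : 0 < ∑ i : Bool, ω w * α true * υ i * f x w i :=
      Finset.sum_pos (fun i _ => mul_pos (mul_pos (mul_pos (hω_pos _) (hα_pos _)) (hυ_pos _))
        (hf_pos _ _ _)) Finset.univ_nonempty
    rw [div_eq_iff hpos.ne']
    simp only [Fintype.sum_bool, hcsi4 y w x _ false true]
    ring
  -- context `A = 0`
  have hq : ∀ x', 0 < ∑ w : Bool, ∑ u : Bool, ω w * α false * υ u * f x' w u := fun x' =>
    Finset.sum_pos (fun w _ => Finset.sum_pos (fun i _ =>
      mul_pos (mul_pos (mul_pos (hω_pos _) (hα_pos _)) (hυ_pos _))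
        (hf_pos _ _ _)) Finset.univ_nonempty) Finset.univ_nonempty
  have hk' : ∀ z x', ∑ w : Bool, ∑ u : Bool, ω w * α false * υ u * f x' w u * k z x' false
      = (∑ w : Bool, ∑ u : Bool, ω w * α false * υ u * f x' w u) * k z x' false := by
    intro z x'
    simp only [Finset.sum_mul]
  have hT2 : ∀ z x', (∑ w : Bool, ∑ u : Bool,
      ω w * α false * υ u * f x' w u * k z x' false * g y w x' z false u) =
      (∑ w : Bool, ∑ u : Bool, ω w * υ u * f x' w u * g y true true z false u)
        * (α false * k z x' false) := by
    intro z x'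
    simp only [Finset.sum_mul]
    refine Finset.sum_congr rfl fun w _ => Finset.sum_congr rfl fun u _ => ?_
    rw [hcsi1 y w true x' z u, hcsi2 y true x' true z u]
    ring
  have hT3 : ∀ z x', (∑ w : Bool, ∑ u : Bool,
      ω w * α false * υ u * f x' w u * k z x' false * g y w x' z false u) /
      ((∑ w : Bool, ∑ u : Bool, ω w * α false * υ u * f x' w u) * k z x' false) *
      ((∑ w : Bool, ∑ u : Bool, ω w * α false * υ u * f x' w u) / α false) =
      ∑ w : Bool, ∑ u : Bool, ω w * υ u * f x' w u * g y true true z false u := by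
    intro z x'
    rw [hT2]
    have h1 := (hq x').ne'
    have h2 := (hk_pos z x' false).ne'
    generalize (∑ w : Bool, ∑ u : Bool, ω w * α false * υ u * f x' w u) = q at *
    field_simp
  have hT4 : ∀ z, ∑ x' : Bool, ∑ w : Bool, ∑ u : Bool,
      ω w * υ u * f x' w u * g y true true z false u =
      ∑ u : Bool, υ u * g y true true z false u := by
    intro z
    have hf' : ∀ w u, f true w u = 1 - f false w u := fun w u => by
      have := hf_sum w u
      rw [Fintype.sum_bool] at this
      linarith
    have hw' : ω true = 1 - ω false := by
      rw [Fintype.sum_bool] at hω_sum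
      linarith
    simp only [Fintype.sum_bool, hf', hw']
    ring
  have hk2 : ∀ z, (∑ w : Bool, ∑ u : Bool, ω w * α false * υ u * f x w u) * k z x false /
      (∑ w : Bool, ∑ u : Bool, ω w * α false * υ u * f x w u) = k z x false := fun z =>
    mul_div_cancel_left₀ _ (hq x).ne'
  simp only [hT1, hk', hT3, hT4, hk2]
  have hw' : ω true = 1 - ω false := by
    rw [Fintype.sum_bool] at hω_sum
    linarith
  have hu' : υ true = 1 - υ false := by
    rw [Fintype.sum_bool] at hυ_sum
    linarith
  have hg0 : ∀ w z u, g y w x z false u = g y true true z false u := fun w z u => by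
    rw [hcsi1 y w true x z u, hcsi2 y true x true z u]
  have hg1 : ∀ w z, g y w x z true false = g y w x z true true := fun w z => hcsi4 _ _ _ _ _ _
  simp only [Fintype.sum_bool, hg0, hg1, hw', hu']
  field_simp
  ring
end

section
/- Let α, λ, μ, ν be strictly positive probability mass functions on Bool, and let f_W(·|a,l,m), f_Z(·|w,a,n), f_X(·|z,l), f_Y(·|x,m,n) be strictly positive probability mass functions on Bool for each value of their conditioning arguments in Bool³, Bool³, Bool², Bool³ respectively. Define the joint pmf p on Bool⁸ (coordinates A, L, M, N, W, Z, X, Y) by p(a,l,m,n,w,z,x,y) = α(a)·λ(l)·μ(m)·ν(n)·f_W(w|a,l,m)·f_Z(z|w,a,n)·f_X(x|z,l)·f_Y(y|x,m,n). Assume the context-specific independence: f_W(w|0,l,m) does not depend on l. Then for all x, y: Σ_{a,l,m,n,w,z} α(a)·λ(l)·μ(m)·ν(n)·f_W(w|a,l,m)·f_Z(z|w,a,n)·f_Y(y|x,m,n) = Σ_z P(Z=z | A=0)·P(Y=y | X=x, Z=z, A=0), where P denotes probabilities and conditional probabilities computed from p. -/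
/-- Identification formula for Figure 4(e) of the paper: binary observed `W, Z, X, Y, A`
and latent `L, M, N` with structure `W → Z`, `Z → X`, `X → Y`, `A → W`, `A → Z`,
`L → X`, `L → W`, `M → W`, `M → Y`, `N → Z`, `N → Y`, joint pmf
`p a l m n w z x y = α a * λ l * μ m * ν n * fW w a l m * fZ z w a n * fX x z l * fY y x m n`,
with the context-specific independence `W ⊥ L | A = 0, M` (i.e. `fW w false l m` does not
depend on `l`).  Then
`P(Y=y | do(X=x)) = Σ_{a,l,m,n,w,z} α a * λ l * μ m * ν n * fW w a l m * fZ z w a n * fY y x m n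
  = Σ_z P(Z=z | A=0) * P(Y=y | X=x, Z=z, A=0)`. -/
theorem figure_4e
    (α lam μ ν : Bool → ℝ)
    (fW : Bool → Bool → Bool → Bool → ℝ)  -- fW w a l m = f_W(w | a, l, m)
    (fZ : Bool → Bool → Bool → Bool → ℝ)  -- fZ z w a n = f_Z(z | w, a, n)
    (fX : Bool → Bool → Bool → ℝ)         -- fX x z l = f_X(x | z, l)
    (fY : Bool → Bool → Bool → Bool → ℝ)  -- fY y x m n = f_Y(y | x, m, n)
    (hα_pos : ∀ a, 0 < α a) (hα_sum : ∑ a : Bool, α a = 1)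
    (hlam_pos : ∀ l, 0 < lam l) (hlam_sum : ∑ l : Bool, lam l = 1)
    (hμ_pos : ∀ m, 0 < μ m) (hμ_sum : ∑ m : Bool, μ m = 1)
    (hν_pos : ∀ n, 0 < ν n) (hν_sum : ∑ n : Bool, ν n = 1)
    (hfW_pos : ∀ w a l m, 0 < fW w a l m) (hfW_sum : ∀ a l m, ∑ w : Bool, fW w a l m = 1)
    (hfZ_pos : ∀ z w a n, 0 < fZ z w a n) (hfZ_sum : ∀ w a n, ∑ z : Bool, fZ z w a n = 1)
    (hfX_pos : ∀ x z l, 0 < fX x z l) (hfX_sum : ∀ z l, ∑ x : Bool, fX x z l = 1)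
    (hfY_pos : ∀ y x m n, 0 < fY y x m n) (hfY_sum : ∀ x m n, ∑ y : Bool, fY y x m n = 1)
    (hcsi : ∀ w l l' m, fW w false l m = fW w false l' m) :
    ∀ x y : Bool,
      (∑ a : Bool, ∑ l : Bool, ∑ m : Bool, ∑ n : Bool, ∑ w : Bool, ∑ z : Bool,
        α a * lam l * μ m * ν n * fW w a l m * fZ z w a n * fY y x m n) =
        ∑ z : Bool,
          -- P(Z=z | A=0)
          ((∑ l : Bool, ∑ m : Bool, ∑ n : Bool, ∑ w : Bool, ∑ x' : Bool, ∑ y' : Bool,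
            α false * lam l * μ m * ν n * fW w false l m * fZ z w false n * fX x' z l *
              fY y' x' m n) /
            (∑ l : Bool, ∑ m : Bool, ∑ n : Bool, ∑ w : Bool, ∑ z' : Bool, ∑ x' : Bool,
              ∑ y' : Bool,
              α false * lam l * μ m * ν n * fW w false l m * fZ z' w false n * fX x' z' l *
                fY y' x' m n)) *
          -- P(Y=y | X=x, Z=z, A=0)
          ((∑ l : Bool, ∑ m : Bool, ∑ n : Bool, ∑ w : Bool,
            α false * lam l * μ m * ν n * fW w false l m * fZ z w false n * fX x z l *
              fY y x m n) /
            (∑ l : Bool, ∑ m : Bool, ∑ n : Bool, ∑ w : Bool, ∑ y' : Bool,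
              α false * lam l * μ m * ν n * fW w false l m * fZ z w false n * fX x z l *
                fY y' x m n)) := by
  intro x y
  -- In the context `A = 0` the kernel of `W` does not depend on `L`.
  have hW : ∀ w l m, fW w false l m = fW w false false m := fun w l m => hcsi w l false m
  set G : Bool → ℝ := fun z => ∑ m : Bool, ∑ n : Bool, ∑ w : Bool,
    μ m * ν n * fW w false false m * fZ z w false n with hG
  set H : Bool → ℝ := fun z => ∑ m : Bool, ∑ n : Bool, ∑ w : Bool,
    μ m * ν n * fW w false false m * fZ z w false n * fY y x m n with hH
  set K : Bool → ℝ := fun z => ∑ l : Bool, lam l * fX x z l with hK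
  have hGpos : ∀ z, 0 < G z := fun z =>
    Finset.sum_pos (fun m _ => Finset.sum_pos (fun n _ => Finset.sum_pos (fun w _ =>
      mul_pos (mul_pos (mul_pos (hμ_pos m) (hν_pos n)) (hfW_pos _ _ _ _)) (hfZ_pos _ _ _ _))
      Finset.univ_nonempty) Finset.univ_nonempty) Finset.univ_nonempty
  have hKpos : ∀ z, 0 < K z := fun z =>
    Finset.sum_pos (fun l _ => mul_pos (hlam_pos l) (hfX_pos _ _ _)) Finset.univ_nonempty
  have hl : lam true = 1 - lam false := by
    rw [Fintype.sum_bool] at hlam_sum; linarith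
  -- marginal of `Z` in the context `A = 0`
  have hN1 : ∀ z, (∑ l : Bool, ∑ m : Bool, ∑ n : Bool, ∑ w : Bool, ∑ x' : Bool, ∑ y' : Bool,
            α false * lam l * μ m * ν n * fW w false l m * fZ z w false n * fX x' z l *
              fY y' x' m n) = α false * G z := by
    intro z
    simp only [← Finset.mul_sum, hfY_sum, hfX_sum, mul_one, hW, hG]
    simp only [Fintype.sum_bool, hl]
    ring
  have hD1 : (∑ l : Bool, ∑ m : Bool, ∑ n : Bool, ∑ w : Bool, ∑ z' : Bool, ∑ x' : Bool,
              ∑ y' : Bool,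
              α false * lam l * μ m * ν n * fW w false l m * fZ z' w false n * fX x' z' l *
                fY y' x' m n) = α false := by
    simp only [← Finset.mul_sum, hfY_sum, hfX_sum, hfZ_sum, hfW_sum, hν_sum, hμ_sum, hlam_sum,
      mul_one]
  have hN2 : ∀ z, (∑ l : Bool, ∑ m : Bool, ∑ n : Bool, ∑ w : Bool,
            α false * lam l * μ m * ν n * fW w false l m * fZ z w false n * fX x z l *
              fY y x m n) = α false * K z * H z := by
    intro z
    simp only [hW, hK, hH, Fintype.sum_bool]
    ring
  have hD2 : ∀ z, (∑ l : Bool, ∑ m : Bool, ∑ n : Bool, ∑ w : Bool, ∑ y' : Bool,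
              α false * lam l * μ m * ν n * fW w false l m * fZ z w false n * fX x z l *
                fY y' x m n) = α false * K z * G z := by
    intro z
    simp only [← Finset.mul_sum, hfY_sum, mul_one]
    simp only [hW, hK, hG, Fintype.sum_bool]
    ring
  -- the interventional distribution
  have hL : (∑ a : Bool, ∑ l : Bool, ∑ m : Bool, ∑ n : Bool, ∑ w : Bool, ∑ z : Bool,
        α a * lam l * μ m * ν n * fW w a l m * fZ z w a n * fY y x m n)
        = ∑ m : Bool, ∑ n : Bool, μ m * ν n * fY y x m n := by
    have ha : α true = 1 - α false := by
      rw [Fintype.sum_bool] at hα_sum; linarith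
    simp only [← Finset.sum_mul, ← Finset.mul_sum, hfZ_sum, hfW_sum, mul_one]
    simp only [Fintype.sum_bool, hl, ha]
    ring
  have hR : ∑ z : Bool, H z = ∑ m : Bool, ∑ n : Bool, μ m * ν n * fY y x m n := by
    simp only [hH]
    rw [Finset.sum_comm]
    refine Finset.sum_congr rfl fun m _ => ?_
    rw [Finset.sum_comm]
    refine Finset.sum_congr rfl fun n _ => ?_
    rw [Finset.sum_comm]
    simp only [← Finset.sum_mul, ← Finset.mul_sum, hfZ_sum, hfW_sum, mul_one]
  rw [hL, ← hR, hD1]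
  refine Finset.sum_congr rfl fun z _ => ?_
  rw [hN1, hN2, hD2]
  have h1 := (hα_pos false).ne'
  have h2 := (hGpos z).ne'
  have h3 := (hKpos z).ne'
  field_simp
end

section
/- Let n ≥ 1, and for each j ∈ {1,…,n} let pa(j) ⊆ {1,…,j−1} be a set of parents, let f_j(v_j | v_{pa(j)}) be a strictly positive conditional probability mass function on Bool for each assignment v_{pa(j)} of the parents, let q_j be a strictly positive pmf on Bool (for the intervention indicator I_j), and let r_j be a strictly positive pmf on Bool (the intervention distribution). Define the augmented joint pmf p̃ on Boolⁿ × Boolⁿ (coordinates V₁,…,Vₙ, I₁,…,Iₙ) by p̃(v, i) = Π_{j=1}^n q_j(i_j) · Π_{j=1}^n [ f_j(v_j | v_{pa(j)}) if i_j = 0, and r_j(v_j) if i_j = 1 ]. Fix k ∈ {1,…,n} and x ∈ Bool, and let i* be the intervention assignment with i*_k = 1 and i*_j = 0 for all j ≠ k. Then for every assignment v with v_k = x: P̃( V_j = v_j for all j ≠ k | V_k = x, I = i* ) = Π_{j ≠ k} f_j(v_j | v_{pa(j)}), where the conditional probability is computed from p̃ (well defined by strict positivity). -/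
open Finset

theorem sum_prod_mech_eq_one (n : ℕ) (g : Fin n → Bool → (Fin n → Bool) → ℝ)
    (hl : ∀ (j : Fin n) (b : Bool) (v v' : Fin n → Bool),
      (∀ i, i < j → v i = v' i) → g j b v = g j b v')
    (hs : ∀ j v, ∑ b : Bool, g j b v = 1) :
    ∑ v : Fin n → Bool, ∏ j, g j (v j) v = 1 := by
  induction n with
  | zero => simp
  | succ n ih =>
    rw [← (Fin.consEquiv (fun _ : Fin (n+1) => Bool)).sum_comp, Fintype.sum_prod_type]
    have key : ∀ b : Bool, ∑ w : Fin n → Bool,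
        ∏ j : Fin n, g j.succ (w j) (Fin.cons b w : Fin (n+1) → Bool) = 1 := by
      intro b
      apply ih (fun j c w => g j.succ c (Fin.cons b w : Fin (n+1) → Bool))
      · intro j c v v' h
        apply hl
        intro i hi
        induction i using Fin.cases with
        | zero => simp
        | succ i => simpa using h i (by simpa using hi)
      · intro j v
        exact hs _ _
    have h0 : ∀ (b : Bool) (w : Fin n → Bool),
        g 0 b (Fin.cons b w : Fin (n+1) → Bool) = g 0 b (fun _ => false) := by
      intro b w
      apply hl
      intro i hi
      exact absurd hi (Fin.not_lt_zero i)
    rw [← hs 0 (fun _ => false)]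
    apply Finset.sum_congr rfl
    intro b _
    simp only [Fin.consEquiv, Equiv.coe_fn_mk, Fin.prod_univ_succ, Fin.cons_zero, Fin.cons_succ]
    simp only [h0]
    rw [← Finset.mul_sum, key, mul_one]

/-- The reduction of Section 4.1 of the paper: interventions in a Bayesian network over
binary variables `V₁, …, Vₙ` can be encoded by augmenting each node `Vⱼ` with an
intervention node `Iⱼ` such that when `Iⱼ = 0` (`false`) the variable follows its
observational mechanism `f j` given its parents `pa j`, and when `Iⱼ = 1` (`true`) it
follows `r j` independently of its parents.  For `i*` with `i*_k = 1` and `i*_j = 0` for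
`j ≠ k`, the ordinary conditional distribution
`P̃(V_{−k} = v_{−k} | V_k = x, I = i*)` in the augmented model equals the truncated
factorization `Π_{j ≠ k} f j (v j) v`. -/
theorem intervention_node_reduction
    (n : ℕ) (hn : 1 ≤ n)
    (pa : Fin n → Finset (Fin n))
    (hpa : ∀ j : Fin n, ∀ i ∈ pa j, (i : ℕ) < (j : ℕ))
    (f : Fin n → Bool → (Fin n → Bool) → ℝ)   -- f j b v = f_j(b | v_{pa j})
    (hf_local : ∀ (j : Fin n) (b : Bool) (v v' : Fin n → Bool),
      (∀ i ∈ pa j, v i = v' i) → f j b v = f j b v')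
    (hf_pos : ∀ j b v, 0 < f j b v)
    (hf_sum : ∀ j v, ∑ b : Bool, f j b v = 1)
    (q : Fin n → Bool → ℝ)                    -- pmf of the intervention indicator I_j
    (hq_pos : ∀ j b, 0 < q j b) (hq_sum : ∀ j, ∑ b : Bool, q j b = 1)
    (r : Fin n → Bool → ℝ)                    -- intervention distribution of V_j
    (hr_pos : ∀ j b, 0 < r j b) (hr_sum : ∀ j, ∑ b : Bool, r j b = 1)
    (k : Fin n) (x : Bool) :
    ∀ v : Fin n → Bool, v k = x →
      -- P̃(V = v, I = i*) / P̃(V_k = x, I = i*)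
      ((∏ j : Fin n, q j (if j = k then true else false)) *
          ∏ j : Fin n,
            (if (if j = k then true else false) = false then f j (v j) v else r j (v j))) /
        (∑ v' : Fin n → Bool,
          if v' k = x then
            (∏ j : Fin n, q j (if j = k then true else false)) *
              ∏ j : Fin n,
                (if (if j = k then true else false) = false then f j (v' j) v' else r j (v' j))
          else 0) =
      ∏ j ∈ Finset.univ.erase k, f j (v j) v := by
  intro v hv
  have hsplit : ∀ v : Fin n → Bool, (∏ j : Fin n,
      (if (if j = k then true else false) = false then f j (v j) v else r j (v j)))
      = r k (v k) * ∏ j ∈ Finset.univ.erase k, f j (v j) v := by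
    intro v
    rw [← Finset.mul_prod_erase Finset.univ _ (Finset.mem_univ k)]
    congr 1
    · simp
    · apply Finset.prod_congr rfl
      intro j hj
      simp [Finset.ne_of_mem_erase hj]
  have hone : ∑ v : Fin n → Bool,
      (if v k = x then ∏ j ∈ Finset.univ.erase k, f j (v j) v else 0) = 1 := by
    rw [← sum_prod_mech_eq_one n
      (fun j b v => if j = k then (if b = x then 1 else 0) else f j b v) ?_ ?_]
    · apply Finset.sum_congr rfl
      intro v _
      rw [← Finset.mul_prod_erase Finset.univ _ (Finset.mem_univ k)]
      have : ∏ j ∈ Finset.univ.erase k,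
          (if j = k then (if v j = x then (1:ℝ) else 0) else f j (v j) v)
          = ∏ j ∈ Finset.univ.erase k, f j (v j) v := by
        apply Finset.prod_congr rfl
        intro j hj
        simp [Finset.ne_of_mem_erase hj]
      rw [this]
      simp
    · intro j b v v' h
      by_cases hj : j = k
      · simp [hj]
      · simp only [hj, if_false]
        exact hf_local j b v v' (fun i hi => h i (hpa j i hi))
    · intro j v
      by_cases hj : j = k
      · simp [hj]
      · simp only [hj, if_false]
        exact hf_sum j v
  simp only [hsplit]
  set Q := ∏ j : Fin n, q j (if j = k then true else false) with hQ
  have hQ0 : Q ≠ 0 := (Finset.prod_pos fun j _ => hq_pos j _).ne'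
  have hr0 : r k x ≠ 0 := (hr_pos k x).ne'
  have hden : (∑ v' : Fin n → Bool, if v' k = x then
      Q * (r k (v' k) * ∏ j ∈ Finset.univ.erase k, f j (v' j) v') else 0) = Q * r k x := by
    rw [← mul_one (Q * r k x), ← hone, Finset.mul_sum]
    apply Finset.sum_congr rfl
    intro w _
    split_ifs with h
    · rw [h]; ring
    · simp
  rw [hden, hv]
  field_simp
end

section
/- There exist two strictly positive probability mass functions p and p' on Bool³ (coordinates L, X, Y), factorizing as p(l,x,y) = λ(l)·f(x|l)·g(y|x,l) and p'(l,x,y) = λ'(l)·f'(x|l)·g'(y|x,l) with all factors strictly positive pmfs on Bool, such that p and p' have identical marginal distributions on (X, Y), but there exist x, y ∈ Bool with Σ_l λ(l)·g(y|x,l) ≠ Σ_l λ'(l)·g'(y|x,l). -/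
/-- The basic non-identifiability construction behind Theorem 1 of the paper: for the
causal structure `L → X`, `L → Y`, `X → Y` with `L` latent and binary variables, there
are two strictly positive models `p(l,x,y) = λ l * f x l * g y x l` and
`p'(l,x,y) = λ' l * f' x l * g' y x l` with identical marginals on `(X, Y)` that
disagree on the causal effect `P(Y=y | do(X=x)) = Σ_l λ l * g y x l`. -/
theorem nonidentifiability_construction :
    ∃ (lam lam' : Bool → ℝ) (f f' : Bool → Bool → ℝ) (g g' : Bool → Bool → Bool → ℝ),
      (∀ l, 0 < lam l) ∧ (∑ l : Bool, lam l = 1) ∧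
      (∀ l, 0 < lam' l) ∧ (∑ l : Bool, lam' l = 1) ∧
      (∀ x l, 0 < f x l) ∧ (∀ l, ∑ x : Bool, f x l = 1) ∧
      (∀ x l, 0 < f' x l) ∧ (∀ l, ∑ x : Bool, f' x l = 1) ∧
      (∀ y x l, 0 < g y x l) ∧ (∀ x l, ∑ y : Bool, g y x l = 1) ∧
      (∀ y x l, 0 < g' y x l) ∧ (∀ x l, ∑ y : Bool, g' y x l = 1) ∧
      -- identical observed marginal distributions on (X, Y)
      (∀ x y : Bool, ∑ l : Bool, lam l * f x l * g y x l =
        ∑ l : Bool, lam' l * f' x l * g' y x l) ∧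
      -- disagreement on the causal effect
      ∃ x y : Bool, (∑ l : Bool, lam l * g y x l) ≠ ∑ l : Bool, lam' l * g' y x l := by
  refine ⟨fun _ => 1/2, fun _ => 1/2, fun x l => if x = l then 3/4 else 1/4, fun _ _ => 1/2,
    fun y _ l => if y = l then 3/4 else 1/4, fun y x _ => if y = x then 5/8 else 3/8,
    ?_, ?_, ?_, ?_, ?_, ?_, ?_, ?_, ?_, ?_, ?_, ?_, ?_, true, true, ?_⟩
  all_goals simp only [Bool.forall_bool, Fintype.sum_bool]
  all_goals norm_num
end

section
/- There exists a strictly positive probability mass function p on Bool⁴ (coordinates A, L, X, Y) of the form p(a,l,x,y) = α(a)·λ(l)·f(x|a,l)·g(y|x,a,l), with α, λ strictly positive pmfs on Bool and f, g strictly positive conditional pmfs on Bool, satisfying the context-specific independences that f(x|0,l) does not depend on l and g(y|x,1,l) does not depend on x, such that for some x, y ∈ Bool: Σ_a P(A=a)·P(Y=y | A=a, X=x) ≠ Σ_{a,l} α(a)·λ(l)·g(y|x,a,l), where P denotes probabilities and conditional probabilities computed from p. -/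
/-- The remark following Equation (1) of the paper, for the causal model of Figure 1
(binary `A, L, X, Y`; structure `A → X`, `A → Y`, `L → X`, `L → Y`, `X → Y`; `L` latent;
labels encoding `X ⊥ L | A = 0` and `Y ⊥ X | A = 1, L`): there is a strictly positive
model `p a l x y = α a * λ l * f x a l * g y x a l` satisfying these context-specific
independences for which the back-door adjustment formula
`Σ_a P(A=a) * P(Y=y | A=a, X=x)` differs from the causal effect
`P(Y=y | do(X=x)) = Σ_{a,l} α a * λ l * g y x a l`. -/
theorem backdoor_formula_invalid :
    ∃ (α lam : Bool → ℝ) (f : Bool → Bool → Bool → ℝ) (g : Bool → Bool → Bool → Bool → ℝ),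
      (∀ a, 0 < α a) ∧ (∑ a : Bool, α a = 1) ∧
      (∀ l, 0 < lam l) ∧ (∑ l : Bool, lam l = 1) ∧
      (∀ x a l, 0 < f x a l) ∧ (∀ a l, ∑ x : Bool, f x a l = 1) ∧
      (∀ y x a l, 0 < g y x a l) ∧ (∀ x a l, ∑ y : Bool, g y x a l = 1) ∧
      -- the context-specific independences X ⊥ L | A=0 and Y ⊥ X | A=1, L
      (∀ x l l', f x false l = f x false l') ∧
      (∀ y x x' l, g y x true l = g y x' true l) ∧
      -- back-door adjustment ≠ causal effect
      ∃ x y : Bool,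
        (∑ a : Bool,
          -- P(A=a)
          (∑ l : Bool, ∑ x' : Bool, ∑ y' : Bool, α a * lam l * f x' a l * g y' x' a l) *
          -- P(Y=y | A=a, X=x)
          ((∑ l : Bool, α a * lam l * f x a l * g y x a l) /
            (∑ l : Bool, ∑ y' : Bool, α a * lam l * f x a l * g y' x a l))) ≠
        ∑ a : Bool, ∑ l : Bool, α a * lam l * g y x a l := by
  refine ⟨fun _ => 1/2, fun _ => 1/2,
    fun x a l => if a = true then (if x = l then 3/4 else 1/4) else 1/2,
    fun y _ _ l => if y = l then 3/4 else 1/4, ?_, ?_, ?_, ?_, ?_, ?_, ?_, ?_, ?_, ?_,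
    true, true, ?_⟩
  · intro a; norm_num
  · norm_num
  · intro l; norm_num
  · norm_num
  · intro x a l; cases x <;> cases a <;> cases l <;> norm_num
  · intro a l; cases a <;> cases l <;> norm_num
  · intro y x a l; cases y <;> cases l <;> norm_num
  · intro x a l; cases l <;> norm_num
  · intro x l l'; simp
  · intro y x x' l; rfl
  · norm_num [Fintype.sum_bool]
end
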